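/- arXiv:2308.07746 — 9 statements merged into one kernel-verified Lean document; each statement's English description precedes it below -/
import Mathlib

section
/- Let α be a finite type (the set of items), let n ≥ 1, and let f_1, …, f_n : Finset α → ℝ be submodular functions. Let x ∈ α, and for each bidder j ∈ {1,…,n} let S_j ⊆ T_j be finsets of α with x ∉ T_j. Write c_j = f_j(S_j ∪ {x}) − f_j(S_j) and d_j = f_j(T_j ∪ {x}) − f_j(T_j). Let σ be a permutation of {1,…,n} that sorts the marginals in nonincreasing order, i.e. c_{σ(1)} ≥ c_{σ(2)} ≥ … ≥ c_{σ(n)}, and let ℓ ∈ {0,1,…,n} be such that c_{σ(r)} ≥ 0 for all 1 ≤ r ≤ ℓ and c_{σ(r)} ≤ 0 for all ℓ < r ≤ n. Then for every k ∈ {1,…,n}: d_k + Σ_{r=1}^{ℓ} [σ(r) ≠ k] · 2^{−r} · d_{σ(r)} ≤ 2 · Σ_{r=1}^{ℓ} 2^{−r} · c_{σ(r)}, where [σ(r) ≠ k] is 1 if σ(r) ≠ k and 0 otherwise. -/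
/-- A set function on finsets of `α` is submodular if
`f (A ∪ B) + f (A ∩ B) ≤ f A + f B` for all finsets `A, B`. -/
def Submodular {α : Type*} [DecidableEq α] (f : Finset α → ℝ) : Prop :=
  ∀ A B : Finset α, f (A ∪ B) + f (A ∩ B) ≤ f A + f B

/-- Marginal values of a submodular function are nonincreasing. -/
theorem Submodular.marginal_le {α : Type*} [DecidableEq α] {f : Finset α → ℝ}
    (hf : Submodular f) {S T : Finset α} (hST : S ⊆ T) {x : α} (hx : x ∉ T) :
    f (insert x T) - f T ≤ f (insert x S) - f S := by
  have h := hf (insert x S) T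
  rw [Finset.insert_union, Finset.union_eq_right.2 hST, Finset.insert_inter_of_notMem hx,
    Finset.inter_eq_left.2 hST] at h
  linarith

theorem Fin.sum_Iic_inv_two_pow {n : ℕ} (p : Fin n) :
    ∑ r ∈ Finset.Iic p, (2 : ℝ)⁻¹ ^ (r.val + 1) = 1 - (2 : ℝ)⁻¹ ^ (p.val + 1) := by
  have h (m : ℕ) : ∑ i ∈ Finset.range m, (2 : ℝ)⁻¹ ^ (i + 1) = 1 - (2 : ℝ)⁻¹ ^ m := by
    induction m with
    | zero => simp
    | succ m ih => rw [Finset.sum_range_succ, ih]; ring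
  rw [← h, Nat.range_succ_eq_Iic, ← Fin.map_valEmbedding_Iic, Finset.sum_map]
  rfl

/-- The initial segment up to `p` already bounds a geometrically weighted sum of nonnegative
nonincreasing values from below. -/
theorem one_sub_inv_two_pow_mul_le_sum {n : ℕ} {a : Fin n → ℝ} (ha : Antitone a) {ℓ : ℕ}
    (hpos : ∀ r : Fin n, r.val < ℓ → 0 ≤ a r) {p : Fin n} (hp : p.val < ℓ) :
    (1 - (2 : ℝ)⁻¹ ^ (p.val + 1)) * a p ≤
      ∑ r ∈ Finset.univ.filter (fun r : Fin n => r.val < ℓ), (2 : ℝ)⁻¹ ^ (r.val + 1) * a r := by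
  rw [← Fin.sum_Iic_inv_two_pow, Finset.sum_mul]
  calc ∑ r ∈ Finset.Iic p, (2 : ℝ)⁻¹ ^ (r.val + 1) * a p
      ≤ ∑ r ∈ Finset.Iic p, (2 : ℝ)⁻¹ ^ (r.val + 1) * a r := by
        refine Finset.sum_le_sum fun r hr => ?_
        have := ha (Finset.mem_Iic.1 hr)
        gcongr
    _ ≤ _ := by
        refine Finset.sum_le_sum_of_subset_of_nonneg (fun r hr => ?_) fun r hr _ => ?_
        · have : r ≤ p := Finset.mem_Iic.1 hr
          simp only [Finset.mem_filter, Finset.mem_univ, true_and]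
          omega
        · have := hpos r (Finset.mem_filter.1 hr).2
          positivity

/-- The deterministic per-iteration core of the adversarial-setting analysis:
`d k + ∑_{r < ℓ} [σ r ≠ k] 2^{-(r+1)} d (σ r) ≤ 2 ∑_{r < ℓ} 2^{-(r+1)} c (σ r)`. -/
theorem adversarial_iteration_bound
    {α : Type*} [Fintype α] [DecidableEq α] (n : ℕ) (hn : 1 ≤ n)
    (f : Fin n → Finset α → ℝ) (hf : ∀ j, Submodular (f j))
    (x : α) (S T : Fin n → Finset α)
    (hST : ∀ j, S j ⊆ T j) (hxT : ∀ j, x ∉ T j)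
    (c d : Fin n → ℝ)
    (hc : ∀ j, c j = f j (insert x (S j)) - f j (S j))
    (hd : ∀ j, d j = f j (insert x (T j)) - f j (T j))
    (σ : Equiv.Perm (Fin n))
    (hσ : ∀ r s : Fin n, r ≤ s → c (σ s) ≤ c (σ r))
    (ℓ : ℕ) (hℓ : ℓ ≤ n)
    (hpos : ∀ r : Fin n, r.val < ℓ → 0 ≤ c (σ r))
    (hneg : ∀ r : Fin n, ℓ ≤ r.val → c (σ r) ≤ 0) :
    ∀ k : Fin n,
      d k + ∑ r ∈ Finset.univ.filter (fun r : Fin n => r.val < ℓ),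
        (if σ r ≠ k then (1 : ℝ) else 0) * (2 : ℝ)⁻¹ ^ (r.val + 1) * d (σ r)
      ≤ 2 * ∑ r ∈ Finset.univ.filter (fun r : Fin n => r.val < ℓ),
        (2 : ℝ)⁻¹ ^ (r.val + 1) * c (σ r) := by
  intro k
  have hdc (j : Fin n) : d j ≤ c j := by
    rw [hc, hd]
    exact (hf j).marginal_le (hST j) (hxT j)
  obtain ⟨p, rfl⟩ := σ.surjective k
  set F := Finset.univ.filter (fun r : Fin n => r.val < ℓ) with hF
  have hsum : ∑ r ∈ F, (if σ r ≠ σ p then (1 : ℝ) else 0) * (2 : ℝ)⁻¹ ^ (r.val + 1) * d (σ r) ≤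
      ∑ r ∈ F, (2 : ℝ)⁻¹ ^ (r.val + 1) * c (σ r) -
        if p ∈ F then (2 : ℝ)⁻¹ ^ (p.val + 1) * c (σ p) else 0 := by
    rw [← Finset.sum_ite_eq' F p fun r => (2 : ℝ)⁻¹ ^ (r.val + 1) * c (σ r),
      ← Finset.sum_sub_distrib]
    refine Finset.sum_le_sum fun r _ => ?_
    by_cases hrp : r = p
    · simp [hrp]
    · have := hdc (σ r)
      simp only [ne_eq, EmbeddingLike.apply_eq_iff_eq, hrp, not_false_eq_true, if_true, if_false,
        one_mul, sub_zero]
      gcongr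
  have hdp := hdc (σ p)
  by_cases hp : p.val < ℓ
  · have hle := one_sub_inv_two_pow_mul_le_sum (a := c ∘ σ) (fun r s hrs => hσ r s hrs) hpos hp
    rw [if_pos (by simpa [hF] using hp)] at hsum
    simp only [Function.comp_apply, ← hF] at hle
    linarith
  · have hnonneg : 0 ≤ ∑ r ∈ F, (2 : ℝ)⁻¹ ^ (r.val + 1) * c (σ r) :=
      Finset.sum_nonneg fun r hr =>
        mul_nonneg (by positivity) (hpos r (Finset.mem_filter.1 hr).2)
    rw [if_neg (by simpa [hF] using hp)] at hsum
    linarith [hneg p (not_lt.1 hp)]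
end

section
/- For every real M > 0 and every Boolean b, there exists a function f : Finset (Fin 2) → ℝ that is nonnegative and submodular, with f(∅) = 0 and f({0}) = 1, such that every finset S ⊆ Fin 2 satisfying (0 ∈ S ↔ b = true) has M · f(S) ≤ max_{T ⊆ Fin 2} f(T). (Consequently, no deterministic online algorithm for Submodular Welfare in the adversarial setting can achieve a competitive ratio better than 1/M: the first stage of the algorithm only sees f(∅) = 0 and f({0}) = 1, its decision bit b of whether to take the first item determines the constraint on S, and the adversary then chooses the extension f.) -/
/-- The set function on two items with values `f ∅ = 0`, `f {0} = x`, `f {1} = y`,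
`f {0, 1} = z`. -/
def twoItemUtility (x y z : ℝ) (A : Finset (Fin 2)) : ℝ :=
  if 0 ∈ A then (if 1 ∈ A then z else x) else (if 1 ∈ A then y else 0)

theorem twoItemUtility_nonneg {x y z : ℝ} (hx : 0 ≤ x) (hy : 0 ≤ y) (hz : 0 ≤ z)
    (A : Finset (Fin 2)) : 0 ≤ twoItemUtility x y z A := by
  unfold twoItemUtility
  split_ifs <;> first | assumption | exact le_rfl

theorem twoItemUtility_submodular {x y z : ℝ} (h : z ≤ x + y) (A B : Finset (Fin 2)) :
    twoItemUtility x y z (A ∪ B) + twoItemUtility x y z (A ∩ B) ≤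
      twoItemUtility x y z A + twoItemUtility x y z B := by
  unfold twoItemUtility
  by_cases h₀ : 0 ∈ A <;> by_cases h₁ : 1 ∈ A <;> by_cases k₀ : 0 ∈ B <;>
    by_cases k₁ : 1 ∈ B <;> simp [h₀, h₁, k₀, k₁] <;> linarith

/-- Hardness for deterministic online algorithms: for every `M > 0` and every decision
bit `b` (whether the algorithm assigns the first item), the adversary can extend the
partially revealed utility (`f ∅ = 0`, `f {0} = 1`) to a nonnegative submodular function
on two items such that any resulting solution `S` (which contains item `0` iff `b`)
satisfies `M · f S ≤ max_T f T`. -/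
theorem deterministic_hardness (M : ℝ) (hM : 0 < M) (b : Bool) :
    ∃ f : Finset (Fin 2) → ℝ,
      (∀ A, 0 ≤ f A) ∧
      (∀ A B : Finset (Fin 2), f (A ∪ B) + f (A ∩ B) ≤ f A + f B) ∧
      f ∅ = 0 ∧ f {0} = 1 ∧
      ∀ S : Finset (Fin 2), ((0 : Fin 2) ∈ S ↔ b = true) →
        M * f S ≤ (Finset.univ : Finset (Finset (Fin 2))).sup' Finset.univ_nonempty f := by
  cases b with
  | false =>
    refine ⟨twoItemUtility 1 0 1, twoItemUtility_nonneg zero_le_one le_rfl zero_le_one,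
      twoItemUtility_submodular (by norm_num), by simp [twoItemUtility],
      by simp [twoItemUtility], fun S hS => ?_⟩
    have hS₀ : 0 ∉ S := by simpa using hS
    have hfS : twoItemUtility 1 0 1 S = 0 := by simp [twoItemUtility, hS₀]
    rw [hfS, mul_zero]
    exact (twoItemUtility_nonneg zero_le_one le_rfl zero_le_one ∅).trans
      (Finset.le_sup' _ (Finset.mem_univ _))
  | true =>
    refine ⟨twoItemUtility 1 M 0, twoItemUtility_nonneg zero_le_one hM.le le_rfl,
      twoItemUtility_submodular (by linarith), by simp [twoItemUtility],
      by simp [twoItemUtility], fun S hS => ?_⟩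
    have hS₀ : 0 ∈ S := by simpa using hS
    have hfS : twoItemUtility 1 M 0 S ≤ 1 := by
      simp only [twoItemUtility, hS₀, if_true]
      split_ifs <;> norm_num
    calc M * twoItemUtility 1 M 0 S ≤ M := mul_le_of_le_one_right hM.le hfS
      _ = twoItemUtility 1 M 0 {1} := by simp [twoItemUtility]
      _ ≤ _ := Finset.le_sup' _ (Finset.mem_univ _)
end

section
/- Let α be a finite type, let f : Finset α → ℝ be a nonnegative submodular function, let p ∈ [0,1] be real, and let μ be a probability distribution (PMF) on Finset α such that for every element u ∈ α, the probability under μ that the random set contains u is at most p. Then the expectation E_{S ∼ μ}[f(S)] ≥ (1 − p) · f(∅). -/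
/-- Restricting a submodular function to `T ∪ {a}` instead of `T` changes its value at a set
containing `a` by at least the marginal value of `a` at `T`. -/
theorem Submodular.add_le_inter_insert {α : Type*} [DecidableEq α] {f : Finset α → ℝ}
    (hf : Submodular f) {a : α} {T : Finset α} (ha : a ∉ T) (S : Finset α) :
    f (S ∩ T) + (if a ∈ S then f (insert a T) - f T else 0) ≤ f (S ∩ insert a T) := by
  split_ifs with h
  · have key := hf (S ∩ insert a T) T
    have h1 : S ∩ insert a T ∪ T = insert a T := by grind
    have h2 : S ∩ insert a T ∩ T = S ∩ T := by grind
    rw [h1, h2] at key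
    linarith
  · rw [Finset.inter_insert_of_notMem h, add_zero]

/-- A lower bound for a weighted sum of a nonnegative submodular function restricted to `T`, where
`m` and `q` bound the total weight of the sets containing a given element. -/
theorem Submodular.le_sum_mul_inter {α : Type*} [Fintype α] [DecidableEq α] {f : Finset α → ℝ}
    (hf_nonneg : ∀ A, 0 ≤ f A) (hf : Submodular f) (w : Finset α → ℝ) (hw : ∀ S, 0 ≤ w S) {q : ℝ}
    (hq : ∀ u : α, ∑ S ∈ Finset.univ.filter (fun S : Finset α => u ∈ S), w S ≤ q)
    (T : Finset α) (m : ℝ) (hmq : m ≤ q)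
    (hm : ∀ u ∈ T, m ≤ ∑ S ∈ Finset.univ.filter (fun S : Finset α => u ∈ S), w S) :
    (∑ S, w S - q) * f ∅ + m * f T ≤ ∑ S, w S * f (S ∩ T) := by
  induction T using Finset.induction_on_min_value
    (fun u : α => ∑ S ∈ Finset.univ.filter (fun S : Finset α => u ∈ S), w S)
    generalizing m with
  | empty =>
    simp only [Finset.inter_empty, ← Finset.sum_mul]
    nlinarith [hf_nonneg ∅]
  | insert a T ha hmin ih =>
    have h1 := ih _ (hq a) hmin
    have h2 := mul_le_mul_of_nonneg_right (hm a (Finset.mem_insert_self a T))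
      (hf_nonneg (insert a T))
    have h3 := Finset.sum_le_sum fun S (_ : S ∈ Finset.univ) =>
      mul_le_mul_of_nonneg_left (hf.add_le_inter_insert ha S) (hw S)
    simp only [mul_add, Finset.sum_add_distrib, mul_ite, mul_zero, ← Finset.sum_filter,
      ← Finset.sum_mul] at h3
    linarith

/-- Sampling lemma: if `S` is a random finset (drawn from an arbitrary distribution `μ`)
such that `Pr[u ∈ S] ≤ p` for every element `u`, and `f` is nonnegative submodular, then
`E[f S] ≥ (1 - p) · f ∅`. -/
theorem sampling_lemma {α : Type*} [Fintype α] [DecidableEq α]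
    (f : Finset α → ℝ) (hf_nonneg : ∀ A, 0 ≤ f A) (hf : Submodular f)
    (p : ℝ) (hp0 : 0 ≤ p) (hp1 : p ≤ 1)
    (μ : PMF (Finset α))
    (hμ : ∀ u : α, ∑ S ∈ Finset.univ.filter (fun S : Finset α => u ∈ S),
      (μ S).toReal ≤ p) :
    (1 - p) * f ∅ ≤ ∑ S : Finset α, (μ S).toReal * f S := by
  have htotal : ∑ S, (μ S).toReal = 1 := by
    rw [← ENNReal.toReal_sum fun S _ => μ.apply_ne_top S, ← tsum_fintype (L := .unconditional _),
      μ.tsum_coe, ENNReal.toReal_one]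
  have key := hf.le_sum_mul_inter hf_nonneg (fun S => (μ S).toReal)
    (fun _ => ENNReal.toReal_nonneg) hμ Finset.univ 0 hp0
    (fun _ _ => Finset.sum_nonneg fun _ _ => ENNReal.toReal_nonneg)
  simpa [htotal] using key
end

section
/- Let α be a finite type, let f : Finset α → ℝ be a nonnegative submodular function, let O ⊆ α be a fixed finset, let p ∈ [0,1] be real, and let μ be a probability distribution (PMF) on Finset α such that for every element u ∈ α, the probability under μ that the random set contains u is at most p. Then the expectation E_{S ∼ μ}[f(S ∪ O)] ≥ (1 − p) · f(O). -/
theorem Submodular.insert_union_inter_le {α : Type*} [DecidableEq α] {f : Finset α → ℝ}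
    (hf : Submodular f) (B S T : Finset α) (u : α) :
    f (insert u B ∪ (S ∩ T)) + (if u ∈ S then 0 else f B - f (insert u B)) ≤
      f (B ∪ (S ∩ insert u T)) := by
  split_ifs with hu
  · have h : insert u B ∪ (S ∩ T) = B ∪ (S ∩ insert u T) := by
      ext x; simp only [Finset.mem_union, Finset.mem_inter, Finset.mem_insert]; grind
    rw [h, add_zero]
  · by_cases hB : u ∈ B
    · rw [Finset.insert_eq_of_mem hB, Finset.inter_insert_of_notMem hu]
      simp
    · have h₁ : (B ∪ (S ∩ T)) ∪ insert u B = insert u B ∪ (S ∩ T) := by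
        ext x; simp only [Finset.mem_union, Finset.mem_inter, Finset.mem_insert]; grind
      have h₂ : (B ∪ (S ∩ T)) ∩ insert u B = B := by
        ext x; simp only [Finset.mem_union, Finset.mem_inter, Finset.mem_insert]; grind
      have h := hf (B ∪ (S ∩ T)) (insert u B)
      rw [h₁, h₂] at h
      rw [Finset.inter_insert_of_notMem hu]
      linarith

/-- The elements of `T` are revealed in order of decreasing marginal probability. -/
theorem Submodular.le_sum_weight_mul_union_inter {α : Type*} [Fintype α] [DecidableEq α]
    {f : Finset α → ℝ} (hf_nonneg : ∀ A, 0 ≤ f A) (hf : Submodular f)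
    {w : Finset α → ℝ} (hw : ∀ S, 0 ≤ w S) (hw1 : ∑ S, w S = 1) (T : Finset α) :
    ∀ (B : Finset α) (p : ℝ), 0 ≤ p →
      (∀ u ∈ T, ∑ S ∈ Finset.univ.filter (fun S : Finset α => u ∈ S), w S ≤ p) →
      (1 - p) * f B ≤ ∑ S, w S * f (B ∪ (S ∩ T)) := by
  induction T using Finset.induction_on_max_value
    (fun u => ∑ S ∈ Finset.univ.filter (fun S : Finset α => u ∈ S), w S) with
  | empty =>
    intro B p hp _
    simp only [Finset.inter_empty, Finset.union_empty, ← Finset.sum_mul, hw1]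
    nlinarith [mul_nonneg hp (hf_nonneg B)]
  | insert u T _ hmax ih =>
    intro B p _ hmarg
    set q := ∑ S ∈ Finset.univ.filter (fun S : Finset α => u ∈ S), w S with hq
    have hq0 : 0 ≤ q := Finset.sum_nonneg fun S _ => hw S
    have hqp : q ≤ p := hmarg u (Finset.mem_insert_self u T)
    have hcompl : ∑ S, w S * (if u ∈ S then 0 else f B - f (insert u B)) =
        (1 - q) * (f B - f (insert u B)) := by
      rw [← hw1, hq, Finset.sum_filter, ← Finset.sum_sub_distrib, Finset.sum_mul]
      refine Finset.sum_congr rfl fun S _ => ?_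
      split_ifs <;> ring
    calc (1 - p) * f B ≤ (1 - q) * f B :=
          mul_le_mul_of_nonneg_right (by linarith) (hf_nonneg B)
      _ = (1 - q) * f (insert u B) + (1 - q) * (f B - f (insert u B)) := by ring
      _ ≤ (∑ S, w S * f (insert u B ∪ (S ∩ T))) +
            ∑ S, w S * (if u ∈ S then 0 else f B - f (insert u B)) := by
          rw [hcompl]
          gcongr
          exact ih (insert u B) q hq0 hmax
      _ ≤ ∑ S, w S * f (B ∪ (S ∩ insert u T)) := by
          rw [← Finset.sum_add_distrib]
          refine Finset.sum_le_sum fun S _ => ?_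
          rw [← mul_add]
          exact mul_le_mul_of_nonneg_left (hf.insert_union_inter_le B S T u) (hw S)

/-- Sampling lemma applied to `h(S) = f(S ∪ O)`: if `S` is a random finset (drawn from an
arbitrary distribution `μ`) with `Pr[u ∈ S] ≤ p` for every element `u`, and `f` is
nonnegative submodular, then `E[f (S ∪ O)] ≥ (1 - p) · f O`. -/
theorem sampling_lemma_union {α : Type*} [Fintype α] [DecidableEq α]
    (f : Finset α → ℝ) (hf_nonneg : ∀ A, 0 ≤ f A) (hf : Submodular f)
    (O : Finset α) (p : ℝ) (hp0 : 0 ≤ p) (hp1 : p ≤ 1)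
    (μ : PMF (Finset α))
    (hμ : ∀ u : α, ∑ S ∈ Finset.univ.filter (fun S : Finset α => u ∈ S),
      (μ S).toReal ≤ p) :
    (1 - p) * f O ≤ ∑ S : Finset α, (μ S).toReal * f (S ∪ O) := by
  have hsum : ∑ S, (μ S).toReal = 1 := by
    rw [← ENNReal.toReal_sum fun S _ => μ.apply_ne_top S, ← tsum_fintype (L := .unconditional _),
      μ.tsum_coe, ENNReal.toReal_one]
  have h := hf.le_sum_weight_mul_union_inter hf_nonneg (fun S => ENNReal.toReal_nonneg) hsum
    Finset.univ O p hp0 fun u _ => hμ u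
  simpa only [Finset.inter_univ, Finset.union_comm O] using h
end

section
/- Let α be a finite type and f : Finset α → ℝ a submodular function. Let P_1, …, P_k be pairwise disjoint nonempty finsets of α, let S ⊆ α be a finset, and let I(S) = { j ∈ {1,…,k} : P_j ∩ S = ∅ } be the indices of parts not intersecting S. For each j ∈ I(S), let m_j ∈ P_j satisfy f(S ∪ {m_j}) − f(S) ≥ f(S ∪ {u}) − f(S) for every u ∈ P_j. Let O ⊆ α be a finset with O ∩ S = ∅ and |O ∩ P_j| = 1 for every j ∈ I(S) and O ⊆ ⋃_{j ∈ I(S)} P_j. Then Σ_{j ∈ I(S)} (f(S ∪ {m_j}) − f(S)) ≥ f(S ∪ O) − f(S). -/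
/-- The gain of adding a set to `S` under a submodular function is at most the sum of the
gains of adding its elements one at a time to `S`. -/
theorem Submodular.union_sub_le_sum_insert_sub {α : Type*} [DecidableEq α]
    {f : Finset α → ℝ} (hf : Submodular f) (S T : Finset α) :
    f (S ∪ T) - f S ≤ ∑ u ∈ T, (f (insert u S) - f S) := by
  induction T using Finset.induction_on with
  | empty => simp
  | insert a T ha ih =>
    rw [Finset.sum_insert ha]
    by_cases haS : a ∈ S
    · have hU : S ∪ insert a T = S ∪ T := by grind
      rw [hU, Finset.insert_eq_of_mem haS]
      linarith
    · have hU : (S ∪ T) ∪ insert a S = S ∪ insert a T := by grind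
      have hI : (S ∪ T) ∩ insert a S = S := by grind
      have h := hf (S ∪ T) (insert a S)
      rw [hU, hI] at h
      linarith

/-- One-iteration gain bound for the Smooth Residual Random Greedy on a partition
matroid: the total marginal gain of the greedy candidates `m j` over the free parts
is at least the gain of an optimal extension `O` using one element per free part. -/
theorem greedy_candidates_beat_optimal_extension
    {α : Type*} [Fintype α] [DecidableEq α] (f : Finset α → ℝ) (hf : Submodular f)
    (k : ℕ) (P : Fin k → Finset α)
    (hdisj : ∀ i j : Fin k, i ≠ j → Disjoint (P i) (P j))
    (hne : ∀ j : Fin k, (P j).Nonempty)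
    (S : Finset α) (m : Fin k → α)
    (hm : ∀ j : Fin k, P j ∩ S = ∅ →
      m j ∈ P j ∧ ∀ u ∈ P j, f (insert u S) - f S ≤ f (insert (m j) S) - f S)
    (O : Finset α) (hOS : O ∩ S = ∅)
    (hO1 : ∀ j : Fin k, P j ∩ S = ∅ → (O ∩ P j).card = 1)
    (hOsub : O ⊆ (Finset.univ.filter (fun j : Fin k => P j ∩ S = ∅)).biUnion P) :
    f (S ∪ O) - f S ≤
      ∑ j ∈ Finset.univ.filter (fun j : Fin k => P j ∩ S = ∅),
        (f (insert (m j) S) - f S) := by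
  have hO : O = (Finset.univ.filter (fun j : Fin k => P j ∩ S = ∅)).biUnion
      (fun j => O ∩ P j) := by
    rw [← Finset.inter_biUnion, Finset.inter_eq_left.mpr hOsub]
  refine (hf.union_sub_le_sum_insert_sub S O).trans ?_
  conv_lhs => rw [hO]
  rw [Finset.sum_biUnion fun i _ j _ hij =>
    (hdisj i j hij).mono Finset.inter_subset_right Finset.inter_subset_right]
  refine Finset.sum_le_sum fun j hj => ?_
  have hj' := (Finset.mem_filter.mp hj).2
  obtain ⟨u, hu⟩ := Finset.card_eq_one.mp (hO1 j hj')
  have hmem : u ∈ O ∩ P j := hu ▸ Finset.mem_singleton_self u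
  rw [hu, Finset.sum_singleton]
  exact (hm j hj').2 u (Finset.mem_inter.mp hmem).2
end

section
/- Let α be a finite type and f : Finset α → ℝ a nonnegative submodular function. Let S, O, M ⊆ α be finsets with S ∩ O = ∅ and S ∩ M = ∅, and let h : M → O be a bijection such that h(u) = u for every u ∈ M ∩ O. Assume moreover that f(S ∪ (O \ {v})) ≤ f(S ∪ O) for every v ∈ O. Then Σ_{u ∈ M} ( f(S ∪ {u} ∪ (O \ {h(u)})) − f(S ∪ O) ) ≥ f(S) − 2 · f(S ∪ O). -/
/-- The sum of the marginal values of the elements of `T` over `A` bounds the marginal value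
of `T` over `A`. -/
theorem Submodular.sub_le_sum_insert {α : Type*} [DecidableEq α] {f : Finset α → ℝ}
    (hf : Submodular f) (A T : Finset α) :
    f (A ∪ T) - f A ≤ ∑ u ∈ T, (f (insert u A) - f A) := by
  induction T using Finset.induction_on with
  | empty => simp
  | insert a T ha ih =>
    rw [Finset.sum_insert ha]
    have hsub := hf (insert a A) (A ∪ T)
    have hunion : insert a A ∪ (A ∪ T) = A ∪ insert a T := by grind
    have hinter : insert a A ∩ (A ∪ T) = A := by grind
    rw [hunion, hinter] at hsub
    linarith

/-- The loss from removing `T` from `A` is at least the sum of the losses from removing its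
elements one at a time. -/
theorem Submodular.sub_le_sum_erase {α : Type*} [DecidableEq α] {f : Finset α → ℝ}
    (hf : Submodular f) (A T : Finset α) :
    f (A \ T) - f A ≤ ∑ v ∈ T, (f (A.erase v) - f A) := by
  induction T using Finset.induction_on with
  | empty => simp
  | insert a T ha ih =>
    rw [Finset.sum_insert ha]
    have hsub := hf (A.erase a) (A \ T)
    have hunion : A.erase a ∪ A \ T = A := by grind
    have hinter : A.erase a ∩ (A \ T) = A \ insert a T := by grind
    rw [hunion, hinter] at hsub
    linarith


/-- Key exchange inequality (deterministic core of the improved analysis of the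
Smooth Residual Random Greedy): for a nonnegative submodular `f`, current solution `S`,
optimal extension `O` (removing any single element of `O` cannot increase the value),
candidate set `M`, and a bijection `h : M → O` fixing `M ∩ O`, we have
`∑_{u ∈ M} ( f(S ∪ {u} ∪ (O \ {h u})) - f(S ∪ O) ) ≥ f S - 2 · f (S ∪ O)`. -/
theorem exchange_inequality {α : Type*} [Fintype α] [DecidableEq α]
    (f : Finset α → ℝ) (hf_nonneg : ∀ A, 0 ≤ f A) (hf : Submodular f)
    (S O M : Finset α) (hSO : S ∩ O = ∅) (hSM : S ∩ M = ∅)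
    (h : α → α) (hbij : Set.BijOn h ↑M ↑O)
    (hfix : ∀ u ∈ M ∩ O, h u = u)
    (hopt : ∀ v ∈ O, f (S ∪ O.erase v) ≤ f (S ∪ O)) :
    f S - 2 * f (S ∪ O) ≤
      ∑ u ∈ M, (f (insert u (S ∪ O.erase (h u))) - f (S ∪ O)) := by
  have hSO' : Disjoint S O := Finset.disjoint_iff_inter_eq_empty.mpr hSO
  have herase : ∀ v ∈ O, S ∪ O.erase v = (S ∪ O).erase v := fun v hv => by
    rw [Finset.erase_union_distrib, Finset.erase_eq_of_notMem (Finset.disjoint_right.mp hSO' hv)]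
  have hswap : ∀ u ∈ M, (f (insert u (S ∪ O)) - f (S ∪ O))
      + (f (S ∪ O.erase (h u)) - f (S ∪ O))
      ≤ f (insert u (S ∪ O.erase (h u))) - f (S ∪ O) := by
    intro u hu
    have hv : h u ∈ O := hbij.mapsTo hu
    by_cases huO : u ∈ O
    · have hopt_u := hopt (h u) hv
      have hu_fix := hfix u (Finset.mem_inter.mpr ⟨hu, huO⟩)
      have hinsert : insert u (S ∪ O.erase u) = S ∪ O := by grind
      rw [hu_fix] at hopt_u ⊢
      rw [hinsert, Finset.insert_eq_of_mem (Finset.mem_union_right S huO)]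
      linarith
    · have huS : u ∉ S := fun huS => by
        simpa [hSM] using Finset.mem_inter.mpr ⟨huS, hu⟩
      have hsub := hf (insert u (S ∪ O.erase (h u))) (S ∪ O)
      have hunion : insert u (S ∪ O.erase (h u)) ∪ (S ∪ O) = insert u (S ∪ O) := by grind
      have hinter : insert u (S ∪ O.erase (h u)) ∩ (S ∪ O) = S ∪ O.erase (h u) := by grind
      rw [hunion, hinter] at hsub
      linarith
  have hreindex : ∑ u ∈ M, (f (S ∪ O.erase (h u)) - f (S ∪ O))
      = ∑ v ∈ O, (f ((S ∪ O).erase v) - f (S ∪ O)) :=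
    Finset.sum_nbij h hbij.mapsTo hbij.injOn hbij.surjOn
      fun u hu => by rw [herase (h u) (hbij.mapsTo hu)]
  have hsum := Finset.sum_le_sum hswap
  rw [Finset.sum_add_distrib, hreindex] at hsum
  have hadd := hf.sub_le_sum_insert (S ∪ O) M
  have hremove := hf.sub_le_sum_erase (S ∪ O) O
  rw [Finset.union_sdiff_cancel_right hSO'] at hremove
  linarith [hf_nonneg (S ∪ O ∪ M)]
end

section
/- Let k ≥ 2 be a natural number, let V ≥ 0 be real, let a = (3 − √5)/2 and b = (3 + √5)/2, and let s, g : ℕ → ℝ be sequences satisfying s(0) ≥ 0, g(0) ≥ V, and for every i ≥ 1: s(i) ≥ (1 − 1/k)·s(i−1) + (1/k)·g(i−1) and g(i) ≥ (1 − 2/k)·g(i−1) + (1/k)·s(i−1). Then for every i ≥ 0: s(i) ≥ (V/√5) · ( (1 − a/k)^i − (1 − b/k)^i ) and g(i) ≥ (V/(2√5)) · ( (√5 − 1)·(1 − a/k)^i + (√5 + 1)·(1 − b/k)^i ). -/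
/-- Solution of the joint recursion (Lemma 3.4 of the paper in abstract form):
if `s 0 ≥ 0`, `g 0 ≥ V`, `s i ≥ (1 - 1/k) s (i-1) + (1/k) g (i-1)` and
`g i ≥ (1 - 2/k) g (i-1) + (1/k) s (i-1)`, then with `a = (3 - √5)/2` and
`b = (3 + √5)/2`:
`s i ≥ (V/√5) ((1 - a/k)^i - (1 - b/k)^i)` and
`g i ≥ (V/(2√5)) ((√5 - 1)(1 - a/k)^i + (√5 + 1)(1 - b/k)^i)`. -/
theorem joint_recursion_bound (k : ℕ) (hk : 2 ≤ k) (V : ℝ) (hV : 0 ≤ V)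
    (a b : ℝ) (ha : a = (3 - Real.sqrt 5) / 2) (hb : b = (3 + Real.sqrt 5) / 2)
    (s g : ℕ → ℝ) (hs0 : 0 ≤ s 0) (hg0 : V ≤ g 0)
    (hs : ∀ i : ℕ, 1 ≤ i →
      (1 - 1 / (k : ℝ)) * s (i - 1) + (1 / (k : ℝ)) * g (i - 1) ≤ s i)
    (hg : ∀ i : ℕ, 1 ≤ i →
      (1 - 2 / (k : ℝ)) * g (i - 1) + (1 / (k : ℝ)) * s (i - 1) ≤ g i) :
    ∀ i : ℕ,
      (V / Real.sqrt 5) * ((1 - a / (k : ℝ)) ^ i - (1 - b / (k : ℝ)) ^ i) ≤ s i ∧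
      (V / (2 * Real.sqrt 5)) * ((Real.sqrt 5 - 1) * (1 - a / (k : ℝ)) ^ i
        + (Real.sqrt 5 + 1) * (1 - b / (k : ℝ)) ^ i) ≤ g i := by
  have h5 : Real.sqrt 5 ^ 2 = 5 := Real.sq_sqrt (by norm_num)
  have h5_pos : 0 < Real.sqrt 5 := Real.sqrt_pos.mpr (by norm_num)
  have hk' : (2 : ℝ) ≤ k := by exact_mod_cast hk
  have hr : 0 ≤ 1 / (k : ℝ) := by positivity
  have hr' : 1 / (k : ℝ) ≤ 1 / 2 := one_div_le_one_div_of_le (by norm_num) hk'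
  intro i
  induction i with
  | zero =>
    refine ⟨by simpa using hs0, le_trans (le_of_eq ?_) hg0⟩
    field_simp
    ring
  | succ n ih =>
    obtain ⟨ihs, ihg⟩ := ih
    have hsn := hs (n + 1) n.succ_pos
    have hgn := hg (n + 1) n.succ_pos
    rw [Nat.add_sub_cancel] at hsn hgn
    constructor
    · refine le_trans (le_trans (le_of_eq ?_) (add_le_add
        (mul_le_mul_of_nonneg_left ihs (by linarith : 0 ≤ 1 - 1 / (k : ℝ)))
        (mul_le_mul_of_nonneg_left ihg hr))) hsn
      rw [pow_succ, pow_succ]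
      generalize (1 - a / (k : ℝ)) ^ n = A
      generalize (1 - b / (k : ℝ)) ^ n = B
      subst ha hb
      field_simp
      ring
    · have h2 : 2 / (k : ℝ) = 2 * (1 / k) := by ring
      refine le_trans (le_trans (le_of_eq ?_) (add_le_add
        (mul_le_mul_of_nonneg_left ihg (by linarith : 0 ≤ 1 - 2 / (k : ℝ)))
        (mul_le_mul_of_nonneg_left ihs hr))) hgn
      rw [pow_succ, pow_succ]
      generalize (1 - a / (k : ℝ)) ^ n = A
      generalize (1 - b / (k : ℝ)) ^ n = B
      subst ha hb
      linear_combination (V / (4 * Real.sqrt 5) / k * (A - B)) * h5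
end

section
/- Let a = (3 − √5)/2, b = (3 + √5)/2, and x = ln(b/a)/√5. Then (e^{−x·a} − e^{−x·b}) / √5 ≥ 0.27493. -/
/-- The numeric bound yielding the `≈ 0.27493` approximation guarantee:
with `a = (3 - √5)/2`, `b = (3 + √5)/2` and `x = ln(b/a)/√5`,
`(e^{-x·a} - e^{-x·b}) / √5 ≥ 0.27493`. -/
theorem numeric_ratio_bound (a b x : ℝ)
    (ha : a = (3 - Real.sqrt 5) / 2) (hb : b = (3 + Real.sqrt 5) / 2)
    (hx : x = Real.log (b / a) / Real.sqrt 5) :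
    (Real.exp (-x * a) - Real.exp (-x * b)) / Real.sqrt 5 ≥ 0.27493 := by
  have hs : √5 * √5 = 5 := Real.mul_self_sqrt (by norm_num)
  have hs_lower : 2.236067 < √5 := Real.lt_sqrt_of_sq_lt (by norm_num)
  have hs_upper : √5 < 2.236068 := (Real.sqrt_lt' (by norm_num)).2 (by norm_num)
  have hs_pos : 0 < √5 := by linarith
  have hab : a * b = 1 := by rw [ha, hb]; linear_combination -hs / 4
  have hsub : b - a = √5 := by rw [ha, hb]; ring
  have ha_pos : 0 < a := by rw [ha]; linarith
  have hb_pos : 0 < b := by rw [hb]; linarith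
  have hquot : b / a = b ^ 2 := by
    rw [div_eq_iff ha_pos.ne']; linear_combination -b * hab
  have hlog : x * √5 = 2 * Real.log b := by
    rw [hx, hquot, Real.log_pow]; field_simp; norm_num [mul_comm]
  -- `x` is the stationary point of the difference, which therefore equals `a * exp (-x * a)`.
  have hexp : Real.exp (-x * b) = Real.exp (-x * a) * a ^ 2 := by
    have hrate : -x * b = -x * a + (-Real.log b + -Real.log b) := by
      linear_combination -x * hsub - hlog
    have hinv : b⁻¹ = a := inv_eq_of_mul_eq_one_left hab
    rw [hrate, Real.exp_add, Real.exp_add, Real.exp_neg, Real.exp_log hb_pos, hinv]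
    ring
  have hvalue : (Real.exp (-x * a) - Real.exp (-x * b)) / √5 = Real.exp (-x * a) * a := by
    rw [hexp, div_eq_iff hs_pos.ne', ← hsub]
    linear_combination -Real.exp (-x * a) * hab
  have hlog_b : Real.log b ≤ 0.96243 := by
    rw [Real.log_le_iff_le_exp hb_pos]
    have h := Real.sum_le_exp_of_nonneg (x := 0.96243) (by norm_num) 11
    norm_num [Finset.sum_range_succ, Nat.factorial] at h
    rw [hb]
    norm_num at hs_upper ⊢
    linarith
  have hxa : x * a ≤ 0.328809 := by
    have hx_upper : x ≤ 0.86083 := by nlinarith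
    have ha_upper : a ≤ 0.3819665 := by rw [ha]; linarith
    nlinarith
  have hexp_upper : Real.exp 0.328809 ≤ 1.38932 := by
    have h := Real.exp_bound' (x := 0.328809) (by norm_num) (by norm_num) (n := 8) (by norm_num)
    norm_num [Finset.sum_range_succ, Nat.factorial] at h ⊢
    linarith
  have hexp_lower : (1.38932 : ℝ)⁻¹ ≤ Real.exp (-x * a) := by
    rw [neg_mul, Real.exp_neg]
    exact inv_anti₀ (Real.exp_pos _) ((Real.exp_le_exp.2 hxa).trans hexp_upper)
  have ha_lower : 0.381966 ≤ a := by rw [ha]; linarith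
  rw [hvalue, ge_iff_le]
  calc (0.27493 : ℝ) ≤ (1.38932 : ℝ)⁻¹ * 0.381966 := by norm_num
    _ ≤ Real.exp (-x * a) * a := by gcongr
end

section
/- Let a = (3 − √5)/2, b = (3 + √5)/2, and x = ln(b/a)/√5. Then for every real k ≥ 3: (1 − a/k)^{x·k} − (1 − b/k)^{x·k} ≥ e^{−x·a} − e^{−x·b}, where powers with real exponents denote real powers (note 1 − b/k ≥ 0 since b < 3 ≤ k). -/
lemma Real.add_sq_div_two_le_neg_log_one_sub {u : ℝ} (h0 : 0 ≤ u) (h1 : u < 1) :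
    u + u ^ 2 / 2 ≤ -Real.log (1 - u) := by
  have h := Real.hasSum_pow_div_log_of_abs_lt_one (abs_lt.2 ⟨by linarith, h1⟩)
  have := sum_le_hasSum (Finset.range 2) (fun i _ => by positivity) h
  norm_num [Finset.sum_range_succ] at this
  linarith

lemma Real.exp_mul_one_sub_le_one_sub_div_rpow {a x k : ℝ} (hx : 0 ≤ x) (hk : 0 < k)
    (hak : a < k) :
    Real.exp (-x * a) * (1 - x * a ^ 2 / (k - a)) ≤ (1 - a / k) ^ (x * k) := by
  have hka : 0 < k - a := sub_pos.2 hak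
  have hpos : 0 < 1 - a / k := by rw [sub_pos, div_lt_one hk]; exact hak
  have hlog : -(a / (k - a)) ≤ Real.log (1 - a / k) := by
    have h := Real.one_sub_inv_le_log_of_pos hpos
    have e : 1 - (1 - a / k)⁻¹ = -(a / (k - a)) := by
      rw [one_sub_div hk.ne', inv_div]
      field_simp
      ring
    rwa [e] at h
  calc Real.exp (-x * a) * (1 - x * a ^ 2 / (k - a))
      ≤ Real.exp (-x * a) * Real.exp (-(x * a ^ 2 / (k - a))) := by
        gcongr
        exact Real.one_sub_le_exp_neg _
    _ = Real.exp (-(a / (k - a)) * (x * k)) := by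
        rw [← Real.exp_add]
        congr 1
        field_simp
        ring
    _ ≤ (1 - a / k) ^ (x * k) := by
        rw [Real.rpow_def_of_pos hpos]
        gcongr

lemma Real.one_sub_div_rpow_le_exp_div {b x k : ℝ} (hb : 0 ≤ b) (hx : 0 ≤ x) (hbk : b < k) :
    (1 - b / k) ^ (x * k) ≤ Real.exp (-x * b) / (1 + x * b ^ 2 / (2 * k)) := by
  have hk : 0 < k := hb.trans_lt hbk
  have h1 : b / k < 1 := (div_lt_one hk).2 hbk
  have hlog := Real.add_sq_div_two_le_neg_log_one_sub (div_nonneg hb hk.le) h1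
  calc (1 - b / k) ^ (x * k)
      ≤ Real.exp (-(b / k + (b / k) ^ 2 / 2) * (x * k)) := by
        rw [Real.rpow_def_of_pos (sub_pos.2 h1)]
        gcongr
        linarith
    _ = Real.exp (-x * b) / Real.exp (x * b ^ 2 / (2 * k)) := by
        rw [← Real.exp_sub]
        congr 1
        field_simp
        ring
    _ ≤ Real.exp (-x * b) / (1 + x * b ^ 2 / (2 * k)) := by
        gcongr
        linarith [Real.add_one_le_exp (x * b ^ 2 / (2 * k))]

/-- The limiting monotonicity bound used in Lemma 3.5 of the paper: with
`a = (3 - √5)/2`, `b = (3 + √5)/2` and `x = ln(b/a)/√5`, for every real `k ≥ 3`: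
`(1 - a/k)^{x·k} - (1 - b/k)^{x·k} ≥ e^{-x·a} - e^{-x·b}` (real powers). -/
theorem finite_k_vs_limit (a b x : ℝ)
    (ha : a = (3 - Real.sqrt 5) / 2) (hb : b = (3 + Real.sqrt 5) / 2)
    (hx : x = Real.log (b / a) / Real.sqrt 5) :
    ∀ k : ℝ, 3 ≤ k →
      (1 - a / k) ^ (x * k) - (1 - b / k) ^ (x * k)
        ≥ Real.exp (-x * a) - Real.exp (-x * b) := by
  intro k hk
  have hs : Real.sqrt 5 ^ 2 = 5 := Real.sq_sqrt (by norm_num)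
  have hs1 : 2.2 < Real.sqrt 5 := Real.lt_sqrt_of_sq_lt (by norm_num)
  have hs2 : Real.sqrt 5 < 2.25 := (Real.sqrt_lt' (by norm_num)).2 (by norm_num)
  have hab : a * b = 1 := by rw [ha, hb]; linarith
  have hb2 : b ^ 2 = 3 * b - 1 := by rw [hb]; linarith
  have ha0 : 0 < a := by linarith
  have hb0 : 0 < b := by linarith
  have hba : b / a = b ^ 2 := by
    rw [div_eq_iff ha0.ne']
    linear_combination (-b) * hab
  have hlogb : Real.log b ≤ 1 := by
    rw [Real.log_le_iff_le_exp hb0]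
    linarith [Real.exp_one_gt_d9]
  have hlogb0 : 0 ≤ Real.log b := Real.log_nonneg (by linarith)
  have hxs : x * Real.sqrt 5 = 2 * Real.log b := by
    rw [hx, hba, Real.log_pow, div_mul_cancel₀ _ (by linarith)]
    norm_num
  have hx0 : 0 ≤ x := by
    rw [hx, hba, Real.log_pow]
    positivity
  have hx1 : x ≤ 1 := by nlinarith
  have hexp : Real.exp (-x * b) = Real.exp (-x * a) * a ^ 2 := by
    have ea : a ^ 2 = Real.exp (-(2 * Real.log b)) := by
      rw [Real.exp_neg, mul_comm, Real.exp_mul, Real.exp_log hb0, Real.rpow_two,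
        ← inv_pow, eq_inv_of_mul_eq_one_left hab]
    rw [ea, ← hxs, ← Real.exp_add, ha, hb]
    congr 1
    ring
  have hka : 0 < k - a := by linarith
  have hA := Real.exp_mul_one_sub_le_one_sub_div_rpow (a := a) hx0 (by linarith : 0 < k)
    (by linarith)
  have hB := Real.one_sub_div_rpow_le_exp_div (b := b) (k := k) hb0.le hx0 (by linarith)
  have hkey : x / (k - a) ≤ 1 - 1 / (1 + x * b ^ 2 / (2 * k)) := by
    have hk0 : 0 < k := by linarith
    have e : 1 - 1 / (1 + x * b ^ 2 / (2 * k)) = x * b ^ 2 / (2 * k + x * b ^ 2) := by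
      field_simp
      ring
    rw [e, div_le_div_iff₀ hka (by positivity), mul_assoc]
    refine mul_le_mul_of_nonneg_left ?_ hx0
    rw [hb2]
    nlinarith
  have := mul_le_mul_of_nonneg_left hkey (by positivity : 0 ≤ Real.exp (-x * a) * a ^ 2)
  rw [hexp] at hB ⊢
  have e1 : Real.exp (-x * a) * (1 - x * a ^ 2 / (k - a)) =
      Real.exp (-x * a) - Real.exp (-x * a) * a ^ 2 * (x / (k - a)) := by ring
  have e2 : Real.exp (-x * a) * a ^ 2 / (1 + x * b ^ 2 / (2 * k)) =
      Real.exp (-x * a) * a ^ 2 * (1 / (1 + x * b ^ 2 / (2 * k))) := by ring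
  rw [e1] at hA
  rw [e2] at hB
  linarith
end
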